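/- Let Ω⁺ ⊂ ℝ³ be a bounded open set with |Ω⁺| = m > 0, and for λ > 0 let e(λ) := min{ 𝓔(u) : u ∈ L¹(ℝ³;[0,1]), u = 0 a.e. on Ω⁺, ∫ u ≤ λ } be the minimal relaxed energy. Then e is continuous on (0,∞), strictly decreasing on (0, m], and constant on [m, ∞). -/

import Mathlib

open MeasureTheory Real Filter

noncomputable section

abbrev E3 := EuclideanSpace ℝ (Fin 3)

/-- The Coulomb kernel in ℝ³. -/
def coul (x y : E3) : ℝ := 1 / (4 * π * ‖x - y‖)

/-- The potential generated by the charge density `χ_{Ω⁺} − u`. -/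
def potentialU (Ωp : Set E3) (u : E3 → ℝ) (x : E3) : ℝ :=
  ∫ y, (Set.indicator Ωp (fun _ => (1:ℝ)) y - u y) * coul x y

/-- The relaxed Coulomb energy
`𝓔(u) = ∫∫ (χ_{Ω⁺}−u)(x) (χ_{Ω⁺}−u)(y) / (4π|x−y|) dx dy`. -/
def relEnergy (Ωp : Set E3) (u : E3 → ℝ) : ℝ :=
  ∫ x, ∫ y, (Set.indicator Ωp (fun _ => (1:ℝ)) x - u x) *
    ((Set.indicator Ωp (fun _ => (1:ℝ)) y - u y) * coul x y)

/-- Admissible relaxed densities: `u ∈ L¹(ℝ³;[0,1])`, `u = 0` a.e. on `Ω⁺`,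
`∫ u ≤ λ`. -/
def RelAdm (Ωp : Set E3) (lam : ℝ) (u : E3 → ℝ) : Prop :=
  Integrable u ∧ (∀ᵐ x, 0 ≤ u x ∧ u x ≤ 1) ∧ (∀ᵐ x, x ∈ Ωp → u x = 0) ∧
    ∫ x, u x ≤ lam

lemma integral_disc_inv_sqrt {ρ : ℝ} (hρ : 0 ≤ ρ) (a : ℝ) :
    ∫ p : EuclideanSpace ℝ (Fin 2), (if ‖p‖ < ρ then 1 / √(‖p‖ ^ 2 + a ^ 2) else 0)
      = 2 * π * (√(ρ ^ 2 + a ^ 2) - |a|) := by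
  rw [integral_fun_norm_addHaar volume
    (fun s : ℝ => if s < ρ then 1 / √(s ^ 2 + a ^ 2) else 0)]
  have hFTC : ∫ s in (0 : ℝ)..ρ, s / √(s ^ 2 + a ^ 2) = √(ρ ^ 2 + a ^ 2) - |a| := by
    have hc : ContinuousOn (fun s : ℝ => √(s ^ 2 + a ^ 2)) (Set.Icc 0 ρ) := by fun_prop
    have hd : ∀ s ∈ Set.Ioo 0 ρ,
        HasDerivAt (fun s : ℝ => √(s ^ 2 + a ^ 2)) (s / √(s ^ 2 + a ^ 2)) s := by
      intro s hs
      have hpos : 0 < s ^ 2 + a ^ 2 := by have := hs.1; positivity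
      have := (((hasDerivAt_id s).pow 2).add_const (a ^ 2)).sqrt hpos.ne'
      refine HasDerivAt.congr_deriv this ?_
      have := Real.sqrt_pos.2 hpos
      simp only [Pi.pow_apply, id]
      field_simp
      norm_num
    have hi : IntervalIntegrable (fun s : ℝ => s / √(s ^ 2 + a ^ 2)) volume 0 ρ := by
      apply intervalIntegral.intervalIntegrable_deriv_of_nonneg
        (g := fun s : ℝ => √(s ^ 2 + a ^ 2))
      · rwa [Set.uIcc_of_le hρ]
      · simpa [hρ] using hd
      · intro s hs
        simp only [hρ, min_eq_left, Set.mem_Ioo] at hs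
        have := hs.1
        positivity
    rw [intervalIntegral.integral_eq_sub_of_hasDerivAt_of_le hρ hc hd hi]
    simp [Real.sqrt_sq_eq_abs]
  have hset : ∫ y in Set.Ioi (0 : ℝ), y ^ (Module.finrank ℝ (EuclideanSpace ℝ (Fin 2)) - 1) •
      (if y < ρ then 1 / √(y ^ 2 + a ^ 2) else 0) = √(ρ ^ 2 + a ^ 2) - |a| := by
    rw [← hFTC, intervalIntegral.integral_of_le hρ, integral_Ioc_eq_integral_Ioo,
      ← integral_indicator measurableSet_Ioi, ← integral_indicator measurableSet_Ioo]
    congr 1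
    ext y
    by_cases h0 : 0 < y <;> by_cases h1 : y < ρ <;>
      simp [Set.indicator, h0, h1, div_eq_mul_inv]
  rw [hset]
  simp [Measure.real, Real.pi_pos.le]
  ring

/-- Splitting off the first coordinate of `ℝ³`. -/
lemma exists_measurePreserving_split : ∃ Φ : E3 ≃ᵐ ℝ × EuclideanSpace ℝ (Fin 2),
    MeasurePreserving Φ volume volume ∧ (∀ x, (Φ x).1 = x 0) ∧
      ∀ x, ‖x‖ ^ 2 = (Φ x).1 ^ 2 + ‖(Φ x).2‖ ^ 2 := by
  let e₁ := (MeasurableEquiv.toLp 2 (Fin 3 → ℝ)).symm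
  let e₂ := MeasurableEquiv.piFinSuccAbove (fun _ : Fin 3 => ℝ) 0
  let e₃ := (MeasurableEquiv.refl ℝ).prodCongr (MeasurableEquiv.toLp 2 (Fin 2 → ℝ))
  refine ⟨(e₁.trans e₂).trans e₃, ?_, ?_, ?_⟩
  · have h₁ : MeasurePreserving e₁ volume volume :=
      EuclideanSpace.volume_preserving_symm_measurableEquiv_toLp (Fin 3)
    have h₂ : MeasurePreserving e₂ volume volume :=
      volume_preserving_piFinSuccAbove (fun _ : Fin 3 => ℝ) 0
    have h₃ : MeasurePreserving e₃ volume volume :=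
      (MeasurePreserving.id volume).prod (PiLp.volume_preserving_toLp (Fin 2))
    exact h₃.comp (h₂.comp h₁)
  · intro x
    rfl
  · intro x
    rw [EuclideanSpace.norm_sq_eq, EuclideanSpace.norm_sq_eq, Fin.sum_univ_succ]
    simp only [Real.norm_eq_abs, sq_abs]
    rfl

lemma integral_sqrt_sub_abs {r d : ℝ} (hr : 0 < r) (hd : 0 < d) :
    ∫ z in (-r)..r, (√(r ^ 2 - z ^ 2 + (z - d) ^ 2) - |z - d|)
      = if d ≤ r then r ^ 2 - d ^ 2 / 3 else 2 * r ^ 3 / (3 * d) := by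
  have hint₁ : IntervalIntegrable (fun z => √(r ^ 2 - z ^ 2 + (z - d) ^ 2)) volume (-r) r := by
    apply Continuous.intervalIntegrable; fun_prop
  have hint₂ : IntervalIntegrable (fun z => |z - d|) volume (-r) r := by
    apply Continuous.intervalIntegrable; fun_prop
  rw [intervalIntegral.integral_sub hint₁ hint₂]
  have h₁ : ∫ z in (-r)..r, √(r ^ 2 - z ^ 2 + (z - d) ^ 2)
      = ((r + d) ^ 3 - |r - d| ^ 3) / (3 * d) := by
    have hd' : ∀ z ∈ Set.Ioo (-r) r, HasDerivAt
        (fun z : ℝ => -(1 / (3 * d)) * ((r ^ 2 - z ^ 2 + (z - d) ^ 2) *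
          √(r ^ 2 - z ^ 2 + (z - d) ^ 2))) (√(r ^ 2 - z ^ 2 + (z - d) ^ 2)) z := by
      intro z hz
      have hpos : 0 < r ^ 2 - z ^ 2 + (z - d) ^ 2 := by
        have : 0 < (r - z) * (r + z) := mul_pos (by linarith [hz.2]) (by linarith [hz.1])
        nlinarith [sq_nonneg (z - d)]
      have hq : HasDerivAt (fun z : ℝ => r ^ 2 - z ^ 2 + (z - d) ^ 2) (-2 * d) z := by
        have := ((((hasDerivAt_id z).pow 2).const_sub (r ^ 2))).add
          (((hasDerivAt_id z).sub_const d).pow 2)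
        refine HasDerivAt.congr_deriv this ?_
        simp only [id]
        norm_num
        ring
      have := (hq.mul (hq.sqrt hpos.ne')).const_mul (-(1 / (3 * d)))
      refine HasDerivAt.congr_deriv this ?_
      have hs := Real.sq_sqrt hpos.le
      have hs0 := Real.sqrt_pos.2 hpos
      generalize √(r ^ 2 - z ^ 2 + (z - d) ^ 2) = s at *
      rw [← hs]
      field_simp
      ring
    rw [intervalIntegral.integral_eq_sub_of_hasDerivAt_of_le (by linarith) (by fun_prop) hd' hint₁]
    have e₁ : r ^ 2 - r ^ 2 + (r - d) ^ 2 = (r - d) ^ 2 := by ring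
    have e₂ : r ^ 2 - (-r) ^ 2 + (-r - d) ^ 2 = (r + d) ^ 2 := by ring
    rw [e₁, e₂, Real.sqrt_sq_eq_abs, Real.sqrt_sq_eq_abs, abs_of_pos (by linarith : 0 < r + d),
      ← sq_abs (r - d)]
    field_simp
    ring
  have h₂ : ∫ z in (-r)..r, |z - d| = ((r - d) * |r - d| + (r + d) ^ 2) / 2 := by
    have hd' : ∀ z ∈ Set.Ioo (-r) r \ {d}, HasDerivAt
        (fun z : ℝ => (z - d) * |z - d| / 2) |z - d| z := by
      intro z hz
      have hne : z - d ≠ 0 := sub_ne_zero.2 hz.2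
      have h1 := (hasDerivAt_id z).sub_const d
      have := (h1.mul ((hasDerivAt_abs hne).comp z h1)).div_const 2
      refine HasDerivAt.congr_deriv this ?_
      simp only [id, Function.comp]
      rw [mul_comm (SignType.sign (z - d) : ℝ), mul_comm (z - d), mul_assoc, one_mul, one_mul]
      rw [sign_mul_self]
      ring
    rw [integral_eq_of_hasDerivAt_off_countable_of_le _ _ (by linarith)
      (Set.countable_singleton d) (by fun_prop) hd' hint₂]
    rw [abs_of_neg (by linarith : -r - d < 0)]
    ring
  rw [h₁, h₂]
  split_ifs with h
  · rw [abs_of_nonneg (by linarith)]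
    field_simp
    ring
  · rw [abs_of_neg (by linarith)]
    field_simp
    ring

lemma integrableOn_coul_ball (y : E3) (r : ℝ) (x : E3) :
    IntegrableOn (fun x => coul x y) (Metric.ball x r) := by
  have h₀ : ∀ R : ℝ, IntegrableOn (fun x : E3 => 1 / (4 * π * ‖x‖)) (Metric.ball 0 R) := by
    intro R
    rw [integrableOn_fun_norm_addHaar volume (f := fun s => 1 / (4 * π * s))]
    have hc : IntegrableOn (fun s : ℝ => s / (4 * π)) (Set.Ioo 0 R) :=
      (Continuous.integrableOn_Icc (by fun_prop)).mono_set Set.Ioo_subset_Icc_self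
    refine hc.congr_fun (fun s hs => ?_) measurableSet_Ioo
    have := hs.1.ne'
    simp only [finrank_euclideanSpace, Fintype.card_fin, smul_eq_mul]
    norm_num
    field_simp
  have h₁ : IntegrableOn (fun x => coul x y) (Metric.ball y (r + dist x y)) := by
    have := (measurePreserving_sub_right (volume : Measure E3) y).integrableOn_comp_preimage
      (MeasurableEquiv.subRight y).measurableEmbedding
      (f := fun x : E3 => 1 / (4 * π * ‖x‖)) (s := Metric.ball 0 (r + dist x y))
    have h := this.2 (h₀ _)
    have hpre : (fun x => x - y) ⁻¹' Metric.ball (0 : E3) (r + dist x y)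
        = Metric.ball y (r + dist x y) := by
      ext z; simp [dist_eq_norm]
    rw [hpre] at h
    exact h
  exact h₁.mono_set (Metric.ball_subset_ball' le_rfl)

/-- Newton's theorem for the uniform ball centred at the origin. -/
lemma integral_ball_zero_coul {r : ℝ} (hr : 0 < r) {y : E3} (hy : y ≠ 0) :
    ∫ x in Metric.ball 0 r, coul x y
      = if ‖y‖ ≤ r then (r ^ 2 - ‖y‖ ^ 2 / 3) / 2 else r ^ 3 / (3 * ‖y‖) := by
  have hd : 0 < ‖y‖ := norm_pos_iff.2 hy
  set d := ‖y‖ with hd_def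
  let y₀ : E3 := EuclideanSpace.single 0 d
  have hy₀ : ‖y₀‖ = ‖y‖ := by simp [y₀, hd_def]
  -- rotate `y` onto the first axis
  let T : E3 ≃ₗᵢ[ℝ] E3 := (ℝ ∙ (y₀ - y))ᗮ.reflection
  have hT : T y₀ = y := Submodule.reflection_sub hy₀
  have hrot : ∫ x in Metric.ball 0 r, coul x y = ∫ x in Metric.ball 0 r, coul x y₀ := by
    rw [← T.measurePreserving.setIntegral_preimage_emb
      T.toHomeomorph.measurableEmbedding]
    have : T ⁻¹' Metric.ball 0 r = Metric.ball 0 r := by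
      ext z; simp
    rw [this]
    congr 1
    ext x
    rw [← hT, coul, coul, ← map_sub, T.norm_map]
  rw [hrot, ← integral_indicator measurableSet_ball]
  obtain ⟨Φ, hΦ, hΦ₀, hΦn⟩ := exists_measurePreserving_split
  let g : ℝ × EuclideanSpace ℝ (Fin 2) → ℝ := fun q =>
    if q.1 ^ 2 + ‖q.2‖ ^ 2 < r ^ 2 then 1 / (4 * π) * (1 / √(‖q.2‖ ^ 2 + (q.1 - d) ^ 2)) else 0
  have hg : (Metric.ball (0 : E3) r).indicator (fun x => coul x y₀) = g ∘ Φ := by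
    ext x
    have hmem : x ∈ Metric.ball (0 : E3) r ↔ (Φ x).1 ^ 2 + ‖(Φ x).2‖ ^ 2 < r ^ 2 := by
      rw [← hΦn, mem_ball_zero_iff, sq_lt_sq₀ (norm_nonneg _) hr.le]
    have hns : ‖x - y₀‖ = √(‖(Φ x).2‖ ^ 2 + ((Φ x).1 - d) ^ 2) := by
      rw [eq_comm, Real.sqrt_eq_iff_mul_self_eq (by positivity) (norm_nonneg _), ← pow_two,
        norm_sub_sq_real, hΦn x, hy₀, hΦ₀]
      simp only [y₀, EuclideanSpace.inner_single_right, ← hd_def]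
      simp
      ring
    simp only [Set.indicator, hmem, Function.comp, g, coul, hns]
    split_ifs
    · field_simp
    · rfl
  have hint : Integrable g := by
    rw [← hΦ.integrable_comp_emb Φ.measurableEmbedding, ← hg,
      integrable_indicator_iff measurableSet_ball]
    exact integrableOn_coul_ball y₀ r 0
  have hcomp : ∫ x, (Metric.ball (0 : E3) r).indicator (fun x => coul x y₀) x = ∫ q, g q := by
    rw [hg]
    exact hΦ.integral_comp Φ.measurableEmbedding g
  have hinner : ∀ z : ℝ, ∫ p, g (z, p) = (Set.Ioo (-r) r).indicator
      (fun z => 1 / 2 * (√(r ^ 2 - z ^ 2 + (z - d) ^ 2) - |z - d|)) z := by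
    intro z
    by_cases hz : z ∈ Set.Ioo (-r) r
    · have hz2 : 0 ≤ r ^ 2 - z ^ 2 := by nlinarith [hz.1, hz.2]
      have := integral_disc_inv_sqrt (Real.sqrt_nonneg (r ^ 2 - z ^ 2)) (z - d)
      rw [Real.sq_sqrt hz2] at this
      have hgz : ∀ p, g (z, p) = 1 / (4 * π) *
          (if ‖p‖ < √(r ^ 2 - z ^ 2) then 1 / √(‖p‖ ^ 2 + (z - d) ^ 2) else 0) := by
        intro p
        have : ‖p‖ < √(r ^ 2 - z ^ 2) ↔ z ^ 2 + ‖p‖ ^ 2 < r ^ 2 := by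
          rw [Real.lt_sqrt (norm_nonneg _)]
          constructor <;> intro h <;> linarith
        simp only [g, this]
        split_ifs <;> simp
      simp only [hgz, integral_const_mul, this, Set.indicator_of_mem hz]
      field_simp
      norm_num
    · have hgz : ∀ p, g (z, p) = 0 := by
        intro p
        have : ¬ (z ^ 2 + ‖p‖ ^ 2 < r ^ 2) := by
          intro h
          have : z ^ 2 < r ^ 2 := by nlinarith [sq_nonneg ‖p‖]
          exact hz (abs_lt.1 (abs_lt_of_sq_lt_sq this hr.le))
        simp only [g, this, if_false]
      simp [hgz, Set.indicator_of_notMem hz]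
  rw [hcomp, Measure.volume_eq_prod, integral_prod _ hint]
  simp only [hinner]
  rw [integral_indicator measurableSet_Ioo, ← integral_Ioc_eq_integral_Ioo,
    ← intervalIntegral.integral_of_le (by linarith), intervalIntegral.integral_const_mul,
    integral_sqrt_sub_abs hr hd]
  split_ifs
  · ring
  · field_simp

lemma integral_ball_coul_center (c y : E3) (r : ℝ) :
    ∫ x in Metric.ball c r, coul x y = ∫ x in Metric.ball 0 r, coul x (y - c) := by
  have h := (measurePreserving_sub_right (volume : Measure E3) c).setIntegral_preimage_emb
    (MeasurableEquiv.subRight c).measurableEmbedding (fun x => coul x (y - c)) (Metric.ball 0 r)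
  have hpre : (fun x => x - c) ⁻¹' Metric.ball (0 : E3) r = Metric.ball c r := by
    ext z; simp [dist_eq_norm]
  rw [← h, hpre]
  simp [coul]

lemma coul_comm (x y : E3) : coul x y = coul y x := by
  rw [coul, coul, norm_sub_rev]

lemma coul_nonneg (x y : E3) : 0 ≤ coul x y := by
  unfold coul; positivity

lemma measurable_coul : Measurable (Function.uncurry coul) := by
  unfold coul Function.uncurry
  fun_prop

lemma volume_real_ball (c : E3) {r : ℝ} (hr : 0 ≤ r) :
    volume.real (Metric.ball c r) = 4 * π / 3 * r ^ 3 := by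
  rw [Measure.real, EuclideanSpace.volume_ball_fin_three, ENNReal.toReal_mul, ENNReal.toReal_pow,
    ENNReal.toReal_ofReal hr, ENNReal.toReal_ofReal (by positivity)]
  ring

lemma integral_ball_coul_le_mul {r : ℝ} (hr : 0 < r) {c y : E3} (hy : y ≠ c) :
    ∫ x in Metric.ball c r, coul x y ≤ volume.real (Metric.ball c r) * coul c y := by
  have hne := sub_ne_zero.2 hy
  have hd : 0 < ‖y - c‖ := norm_pos_iff.2 hne
  rw [integral_ball_coul_center, integral_ball_zero_coul hr hne, volume_real_ball c hr.le, coul,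
    norm_sub_rev c y]
  split_ifs with h
  · have : 4 * π / 3 * r ^ 3 * (1 / (4 * π * ‖y - c‖)) = r ^ 3 / (3 * ‖y - c‖) := by
      field_simp
    rw [this, le_div_iff₀ (by positivity)]
    nlinarith [mul_nonneg (sq_nonneg (r - ‖y - c‖)) (by positivity : 0 ≤ 2 * r + ‖y - c‖)]
  · apply le_of_eq
    field_simp

lemma integral_ball_coul_eq_mul {r : ℝ} (hr : 0 < r) {c y : E3} (hy : r ≤ ‖y - c‖) :
    ∫ x in Metric.ball c r, coul x y = volume.real (Metric.ball c r) * coul c y := by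
  have hd : 0 < ‖y - c‖ := hr.trans_le hy
  rw [integral_ball_coul_center, integral_ball_zero_coul hr (norm_pos_iff.1 hd),
    volume_real_ball c hr.le, coul, norm_sub_rev c y]
  split_ifs with h
  · rw [le_antisymm h hy]
    field_simp
    ring
  · field_simp

lemma integral_ball_zero_coul_le {r : ℝ} (hr : 0 < r) {y : E3} (hy : y ≠ 0) :
    ∫ x in Metric.ball 0 r, coul x y ≤ r ^ 2 / 2 := by
  rw [integral_ball_zero_coul hr hy]
  split_ifs with h
  · linarith [sq_nonneg ‖y‖]
  · push Not at h
    rw [div_le_div_iff₀ (by linarith) (by norm_num)]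
    nlinarith [pow_pos hr 2]

/-- Integrable and essentially bounded charge densities. -/
def BddIntegrable (f : E3 → ℝ) : Prop :=
  Integrable f ∧ ∃ C : ℝ, 0 ≤ C ∧ ∀ᵐ x, |f x| ≤ C

/-- The Coulomb potential of a charge density. -/
def coulPot (f : E3 → ℝ) (x : E3) : ℝ := ∫ y, f y * coul x y

/-- The mutual Coulomb energy of two charge densities. -/
def coulEnergy (f g : E3 → ℝ) : ℝ := ∫ x, f x * coulPot g x

lemma BddIntegrable.add_const_mul {f g : E3 → ℝ} (hf : BddIntegrable f) (hg : BddIntegrable g)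
    (c : ℝ) : BddIntegrable (fun x => f x + c * g x) := by
  obtain ⟨hf1, C, hC, hfC⟩ := hf
  obtain ⟨hg1, D, hD, hgD⟩ := hg
  refine ⟨hf1.add (hg1.const_mul c), C + |c| * D, by positivity, ?_⟩
  filter_upwards [hfC, hgD] with x h1 h2
  calc |f x + c * g x| ≤ |f x| + |c * g x| := abs_add_le _ _
    _ ≤ C + |c| * D := by rw [abs_mul]; gcongr

lemma BddIntegrable.indicator {f : E3 → ℝ} (hf : BddIntegrable f) {s : Set E3}
    (hs : MeasurableSet s) : BddIntegrable (s.indicator f) := by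
  obtain ⟨hf1, C, hC, hfC⟩ := hf
  refine ⟨hf1.indicator hs, C, hC, ?_⟩
  filter_upwards [hfC] with x h1
  by_cases h : x ∈ s <;> simp [h, h1, hC]

lemma bddIntegrable_indicator_one {s : Set E3} (hs : MeasurableSet s) (h : volume s ≠ ⊤) :
    BddIntegrable (s.indicator fun _ => (1 : ℝ)) := by
  refine ⟨(integrable_indicator_iff hs).2 (integrableOn_const h), 1, zero_le_one, ?_⟩
  filter_upwards with x
  by_cases h : x ∈ s <;> simp [h]

lemma integrableOn_coul_ball_right (x c : E3) (r : ℝ) :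
    IntegrableOn (fun y => coul x y) (Metric.ball c r) := by
  simpa only [coul_comm x] using integrableOn_coul_ball x r c

lemma setIntegral_ball_coul_self_le (x : E3) {r : ℝ} (hr : 0 < r) :
    ∫ y in Metric.ball x r, coul x y ≤ 2 * r ^ 2 := by
  let v : E3 := EuclideanSpace.single 0 r
  have hv : ‖v‖ = r := by simp [v, abs_of_pos hr]
  have hv0 : v ≠ 0 := norm_pos_iff.1 (by rwa [hv])
  have hsub : Metric.ball x r ⊆ Metric.ball (x + v) (2 * r) := by
    apply Metric.ball_subset_ball'
    rw [dist_self_add_right, hv]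
    linarith
  calc ∫ y in Metric.ball x r, coul x y ≤ ∫ y in Metric.ball (x + v) (2 * r), coul x y :=
        setIntegral_mono_set (integrableOn_coul_ball_right x _ _)
          (ae_of_all _ fun y => coul_nonneg x y) hsub.eventuallyLE
    _ = ∫ y in Metric.ball 0 (2 * r), coul y (-v) := by
        simp only [coul_comm x]
        rw [integral_ball_coul_center, sub_add_cancel_left]
    _ ≤ (2 * r) ^ 2 / 2 := integral_ball_zero_coul_le (by linarith) (neg_ne_zero.2 hv0)
    _ = 2 * r ^ 2 := by ring

lemma coul_le_of_notMem_ball {x y : E3} (h : y ∉ Metric.ball x 1) : coul x y ≤ 1 := by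
  rw [Metric.mem_ball, dist_comm, dist_eq_norm, not_lt] at h
  rw [coul, div_le_one (by positivity)]
  nlinarith [Real.pi_gt_three]

lemma measurable_coul_right (x : E3) : Measurable (coul x) := by
  unfold coul
  fun_prop

lemma exists_dominating_coul {f : E3 → ℝ} (hf : BddIntegrable f) :
    ∃ K : ℝ, ∀ x, Integrable (fun y => f y * coul x y) ∧ ∫ y, ‖f y * coul x y‖ ≤ K := by
  obtain ⟨hf1, C, hC, hfC⟩ := hf
  refine ⟨C * 2 + ∫ y, |f y|, fun x => ?_⟩
  have hi : Integrable ((Metric.ball x 1).indicator (fun y => coul x y)) :=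
    (integrable_indicator_iff measurableSet_ball).2 (integrableOn_coul_ball_right x x 1)
  have hdom : Integrable (fun y => C * (Metric.ball x 1).indicator (fun y => coul x y) y + |f y|) :=
    (hi.const_mul C).add hf1.abs
  have hle : ∀ᵐ y, ‖f y * coul x y‖ ≤
      C * (Metric.ball x 1).indicator (fun y => coul x y) y + |f y| := by
    filter_upwards [hfC] with y hy
    rw [norm_mul, Real.norm_eq_abs, Real.norm_eq_abs, abs_of_nonneg (coul_nonneg x y)]
    by_cases h : y ∈ Metric.ball x 1
    · rw [Set.indicator_of_mem h]
      have := mul_le_mul_of_nonneg_right hy (coul_nonneg x y)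
      linarith [abs_nonneg (f y)]
    · rw [Set.indicator_of_notMem h]
      have := mul_le_mul_of_nonneg_left (coul_le_of_notMem_ball h) (abs_nonneg (f y))
      linarith
  have hint : Integrable (fun y => f y * coul x y) :=
    hdom.mono' (hf1.aestronglyMeasurable.mul (measurable_coul_right x).aestronglyMeasurable) hle
  refine ⟨hint, ?_⟩
  calc ∫ y, ‖f y * coul x y‖
      ≤ ∫ y, (C * (Metric.ball x 1).indicator (fun y => coul x y) y + |f y|) :=
        integral_mono_ae hint.norm hdom hle
    _ = C * (∫ y in Metric.ball x 1, coul x y) + ∫ y, |f y| := by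
        rw [integral_add (hi.const_mul C) hf1.abs, integral_const_mul,
          integral_indicator measurableSet_ball]
    _ ≤ C * 2 + ∫ y, |f y| := by
        have := setIntegral_ball_coul_self_le x one_pos
        gcongr
        simpa using this

lemma integrable_mul_coul {f : E3 → ℝ} (hf : BddIntegrable f) (x : E3) :
    Integrable (fun y => f y * coul x y) :=
  (exists_dominating_coul hf).choose_spec x |>.1

lemma exists_abs_coulPot_le {f : E3 → ℝ} (hf : BddIntegrable f) :
    ∃ K : ℝ, ∀ x, |coulPot f x| ≤ K := by
  obtain ⟨K, hK⟩ := exists_dominating_coul hf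
  exact ⟨K, fun x => (norm_integral_le_integral_norm _).trans (hK x).2⟩

lemma integrable_prod_coul {f g : E3 → ℝ} (hf : BddIntegrable f) (hg : BddIntegrable g) :
    Integrable (fun p : E3 × E3 => f p.1 * (g p.2 * coul p.1 p.2)) (volume.prod volume) := by
  obtain ⟨K, hK⟩ := exists_dominating_coul hg
  have hmeas : AEStronglyMeasurable (fun p : E3 × E3 => f p.1 * (g p.2 * coul p.1 p.2))
      (volume.prod volume) :=
    hf.1.aestronglyMeasurable.comp_fst.mul
      (hg.1.aestronglyMeasurable.comp_snd.mul measurable_coul.aestronglyMeasurable)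
  rw [integrable_prod_iff hmeas]
  refine ⟨ae_of_all _ fun x => (hK x).1.const_mul (f x), ?_⟩
  refine (hf.1.abs.mul_const K).mono' hmeas.norm.integral_prod_right' (ae_of_all _ fun x => ?_)
  simp only [norm_mul (f x), integral_const_mul]
  rw [norm_mul, norm_norm, Real.norm_eq_abs (f x)]
  gcongr
  rw [Real.norm_of_nonneg (integral_nonneg fun _ => norm_nonneg _)]
  exact (hK x).2

lemma integrable_mul_coulPot {f g : E3 → ℝ} (hf : BddIntegrable f) (hg : BddIntegrable g) :
    Integrable (fun x => f x * coulPot g x) := by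
  simpa only [coulPot, ← integral_const_mul] using (integrable_prod_coul hf hg).integral_prod_left

lemma coulEnergy_comm {f g : E3 → ℝ} (hf : BddIntegrable f) (hg : BddIntegrable g) :
    coulEnergy f g = coulEnergy g f := by
  have h := integral_integral_swap (f := fun x y => f x * (g y * coul x y))
    (integrable_prod_coul hf hg)
  simp only [coulEnergy, coulPot, ← integral_const_mul]
  rw [h]
  congr 1
  ext x
  congr 1
  ext y
  rw [coul_comm x y]
  ring

lemma coulPot_add_const_mul {f g : E3 → ℝ} (hf : BddIntegrable f) (hg : BddIntegrable g)
    (c : ℝ) (x : E3) :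
    coulPot (fun x => f x + c * g x) x = coulPot f x + c * coulPot g x := by
  simp only [coulPot, ← integral_const_mul]
  rw [← integral_add (integrable_mul_coul hf x) ((integrable_mul_coul hg x).const_mul c)]
  congr 1
  ext y
  ring

lemma coulEnergy_add_const_mul {f g : E3 → ℝ} (hf : BddIntegrable f) (hg : BddIntegrable g)
    (c : ℝ) :
    coulEnergy (fun x => f x + c * g x) (fun x => f x + c * g x)
      = coulEnergy f f + 2 * c * coulEnergy f g + c ^ 2 * coulEnergy g g := by
  have h1 : coulEnergy (fun x => f x + c * g x) (fun x => f x + c * g x)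
      = coulEnergy f f + c * coulEnergy f g + c * coulEnergy g f + c ^ 2 * coulEnergy g g := by
    simp only [coulEnergy, ← integral_const_mul, coulPot_add_const_mul hf hg]
    have ff := integrable_mul_coulPot hf hf
    have fg := (integrable_mul_coulPot hf hg).const_mul c
    have gf := (integrable_mul_coulPot hg hf).const_mul c
    have gg := (integrable_mul_coulPot hg hg).const_mul (c ^ 2)
    have h1 := integral_add ff fg
    have h2 := integral_add (ff.add fg) gf
    have h3 := integral_add ((ff.add fg).add gf) gg
    simp only [Pi.add_apply] at h1 h2 h3
    rw [← h1, ← h2, ← h3]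
    congr 1
    ext x
    ring
  rw [h1, coulEnergy_comm hg hf]
  ring

/-- The Coulomb potential with the kernel truncated at distance `ε`. -/
def truncPot (ε : ℝ) (f : E3 → ℝ) (x : E3) : ℝ := ∫ y, f y * (1 / (4 * π * max ‖x - y‖ ε))

lemma truncKernel_le {ε : ℝ} (hε : 0 < ε) (x y : E3) :
    |1 / (4 * π * max ‖x - y‖ ε)| ≤ 1 / (4 * π * ε) := by
  have : 0 < max ‖x - y‖ ε := lt_max_of_lt_right hε
  rw [abs_of_nonneg (by positivity)]
  gcongr
  exact le_max_right _ _

lemma continuous_truncKernel {ε : ℝ} (hε : 0 < ε) {u v : E3 → E3} (hu : Continuous u)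
    (hv : Continuous v) : Continuous (fun p => 1 / (4 * π * max ‖u p - v p‖ ε)) := by
  refine continuous_const.div (by fun_prop) fun p => ?_
  have : 0 < max ‖u p - v p‖ ε := lt_max_of_lt_right hε
  positivity

lemma norm_mul_truncKernel_le {ε : ℝ} (hε : 0 < ε) (f : E3 → ℝ) (x y : E3) :
    ‖f y * (1 / (4 * π * max ‖x - y‖ ε))‖ ≤ ‖f y‖ * (1 / (4 * π * ε)) := by
  rw [norm_mul]
  exact mul_le_mul_of_nonneg_left (truncKernel_le hε x y) (norm_nonneg _)

lemma aestronglyMeasurable_mul_truncKernel {ε : ℝ} (hε : 0 < ε) {f : E3 → ℝ} (hf : Integrable f)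
    (x : E3) : AEStronglyMeasurable (fun y => f y * (1 / (4 * π * max ‖x - y‖ ε))) volume :=
  by
  have h : Continuous fun y : E3 => 1 / (4 * π * max ‖x - y‖ ε) :=
    continuous_truncKernel hε continuous_const continuous_id
  exact hf.aestronglyMeasurable.mul h.aestronglyMeasurable

lemma continuous_truncPot {ε : ℝ} (hε : 0 < ε) {f : E3 → ℝ} (hf : Integrable f) :
    Continuous (truncPot ε f) := by
  refine continuous_of_dominated (fun x => aestronglyMeasurable_mul_truncKernel hε hf x)
    (fun x => ae_of_all _ fun y => norm_mul_truncKernel_le hε f x y) (hf.norm.mul_const _)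
    (ae_of_all _ fun y => ?_)
  have h : Continuous fun x : E3 => 1 / (4 * π * max ‖x - y‖ ε) :=
    continuous_truncKernel hε continuous_id continuous_const
  exact h.const_mul (f y)

lemma tendsto_truncPot {ε : ℝ} (hε : 0 < ε) {f : E3 → ℝ} (hf : Integrable f) :
    Tendsto (truncPot ε f) (cocompact E3) (nhds 0) := by
  have : (cocompact E3).IsCountablyGenerated := by
    rw [← Metric.cobounded_eq_cocompact, ← comap_norm_atTop]
    infer_instance
  have h := tendsto_integral_filter_of_dominated_convergence (μ := (volume : Measure E3))
    (l := cocompact E3) (F := fun x y => f y * (1 / (4 * π * max ‖x - y‖ ε))) (f := fun _ => 0)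
    (fun y => ‖f y‖ * (1 / (4 * π * ε)))
    (Eventually.of_forall fun x => aestronglyMeasurable_mul_truncKernel hε hf x)
    (Eventually.of_forall fun x => ae_of_all _ fun y => norm_mul_truncKernel_le hε f x y)
    (hf.norm.mul_const _) (ae_of_all _ fun y => ?_)
  · rwa [integral_zero] at h
  · have h1 : Tendsto (fun x : E3 => ‖x - y‖) (cocompact E3) atTop := by
      refine tendsto_atTop_mono (f := fun x => ‖x‖ - ‖y‖) (fun x => norm_sub_norm_le x y) ?_
      exact tendsto_atTop_add_const_right _ _ (tendsto_norm_cocompact_atTop)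
    have h2 : Tendsto (fun x : E3 => 4 * π * max ‖x - y‖ ε) (cocompact E3) atTop :=
      (tendsto_atTop_mono (fun x => le_max_left _ _) h1).const_mul_atTop (by positivity)
    simpa using (h2.inv_tendsto_atTop).const_mul (f y)

lemma exists_abs_coulPot_sub_truncPot_le {f : E3 → ℝ} (hf : BddIntegrable f) :
    ∃ C, ∀ ε, 0 < ε → ∀ x, |coulPot f x - truncPot ε f x| ≤ C * (2 * ε ^ 2) := by
  have hf' := hf
  obtain ⟨hf1, C, hC, hfC⟩ := hf'
  refine ⟨C, fun ε hε x => ?_⟩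
  have hT : Integrable (fun y => f y * (1 / (4 * π * max ‖x - y‖ ε))) :=
    (hf1.norm.mul_const _).mono' (aestronglyMeasurable_mul_truncKernel hε hf1 x)
      (ae_of_all _ fun y => norm_mul_truncKernel_le hε f x y)
  rw [coulPot, truncPot, ← integral_sub (integrable_mul_coul hf x) hT]
  have hi : Integrable ((Metric.ball x ε).indicator (fun y => coul x y)) :=
    (integrable_indicator_iff measurableSet_ball).2 (integrableOn_coul_ball_right x x ε)
  calc |∫ y, (f y * coul x y - f y * (1 / (4 * π * max ‖x - y‖ ε)))|
      ≤ ∫ y, C * (Metric.ball x ε).indicator (fun y => coul x y) y := by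
        refine norm_integral_le_of_norm_le (G := ℝ) (hi.const_mul C) ?_
        filter_upwards [hfC, compl_mem_ae_iff.2 (measure_singleton x)] with y hy hne
        rw [← mul_sub, norm_mul]
        refine mul_le_mul hy ?_ (norm_nonneg _) hC
        by_cases h : y ∈ Metric.ball x ε
        · rw [Set.indicator_of_mem h]
          have hm : dist x y < ε := by rwa [Metric.mem_ball, dist_comm] at h
          rw [dist_eq_norm] at hm
          rw [max_eq_right hm.le, Real.norm_eq_abs]
          have h0 : 0 < ‖x - y‖ := norm_sub_pos_iff.2 (Ne.symm hne)
          rw [coul, abs_of_nonneg]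
          · have : 0 ≤ 1 / (4 * π * ε) := by positivity
            linarith
          · rw [sub_nonneg]
            gcongr
        · rw [Set.indicator_of_notMem h]
          rw [Metric.mem_ball, dist_comm, dist_eq_norm, not_lt] at h
          simp [coul, max_eq_left h]
    _ = C * ∫ y in Metric.ball x ε, coul x y := by
        rw [integral_const_mul, integral_indicator measurableSet_ball]
    _ ≤ C * (2 * ε ^ 2) := by
        gcongr
        exact setIntegral_ball_coul_self_le x hε

lemma exists_abs_coulPot_sub_truncPot_lt {f : E3 → ℝ} (hf : BddIntegrable f) {δ : ℝ}
    (hδ : 0 < δ) : ∃ ε > 0, ∀ x, |coulPot f x - truncPot ε f x| < δ := by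
  obtain ⟨C, h⟩ := exists_abs_coulPot_sub_truncPot_le hf
  have ht : Tendsto (fun ε : ℝ => C * (2 * ε ^ 2)) (nhdsWithin 0 (Set.Ioi 0)) (nhds 0) := by
    have : Continuous (fun ε : ℝ => C * (2 * ε ^ 2)) := by fun_prop
    simpa using (this.tendsto 0).mono_left nhdsWithin_le_nhds
  obtain ⟨ε, h1, h2⟩ := ((ht.eventually_lt_const hδ).and self_mem_nhdsWithin).exists
  exact ⟨ε, h2, fun x => (h ε h2 x).trans_lt h1⟩

lemma continuous_coulPot {f : E3 → ℝ} (hf : BddIntegrable f) : Continuous (coulPot f) := by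
  refine continuous_of_uniform_approx_of_continuous fun u hu => ?_
  obtain ⟨δ, hδ, hδu⟩ := Metric.mem_uniformity_dist.1 hu
  obtain ⟨ε, hε, h⟩ := exists_abs_coulPot_sub_truncPot_lt hf hδ
  exact ⟨truncPot ε f, continuous_truncPot hε hf.1, fun x => hδu (h x)⟩

lemma tendsto_coulPot {f : E3 → ℝ} (hf : BddIntegrable f) :
    Tendsto (coulPot f) (cocompact E3) (nhds 0) := by
  refine Metric.tendsto_nhds.2 fun δ hδ => ?_
  obtain ⟨ε, hε, h⟩ := exists_abs_coulPot_sub_truncPot_lt hf (half_pos hδ)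
  filter_upwards [Metric.tendsto_nhds.1 (tendsto_truncPot hε hf.1) (δ / 2) (half_pos hδ)] with x hx
  rw [Real.dist_eq, sub_zero] at hx ⊢
  have h2 := abs_add_le (coulPot f x - truncPot ε f x) (truncPot ε f x)
  rw [sub_add_cancel] at h2
  linarith [h x]

lemma integral_mul_integral_swap {α β : Type*} [MeasurableSpace α] [MeasurableSpace β]
    {μ : Measure α} {ν : Measure β} [SFinite μ] [SFinite ν] {F : α → ℝ} {G : α → β → ℝ}
    (hF : AEStronglyMeasurable F μ) (hG : Measurable (Function.uncurry G))
    (hG₀ : ∀ a b, 0 ≤ G a b) (hGi : ∀ᵐ a ∂μ, Integrable (G a) ν)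
    (hi : Integrable (fun a => F a * ∫ b, G a b ∂ν) μ) :
    ∫ a, F a * ∫ b, G a b ∂ν ∂μ = ∫ b, ∫ a, F a * G a b ∂μ ∂ν := by
  have hmeas : AEStronglyMeasurable (Function.uncurry fun a b => F a * G a b) (μ.prod ν) :=
    hF.comp_fst.mul hG.aestronglyMeasurable
  have hint : Integrable (Function.uncurry fun a b => F a * G a b) (μ.prod ν) := by
    rw [integrable_prod_iff hmeas]
    constructor
    · filter_upwards [hGi] with a ha using ha.const_mul (F a)
    · refine hi.norm.congr (ae_of_all _ fun a => ?_)
      simp only [Function.uncurry, norm_mul, integral_const_mul]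
      rw [Real.norm_of_nonneg (integral_nonneg (hG₀ a))]
      congr 2
      ext b
      rw [Real.norm_of_nonneg (hG₀ a b)]
  simp only [← integral_const_mul]
  exact integral_integral_swap hint

lemma integral_gaussian_mul_gaussian {b : ℝ} (x y : E3) :
    ∫ z : E3, rexp (-(2 * b) * ‖x - z‖ ^ 2) * rexp (-(2 * b) * ‖y - z‖ ^ 2)
      = rexp (-b * ‖x - y‖ ^ 2) * ∫ z : E3, rexp (-(4 * b) * ‖z‖ ^ 2) := by
  rw [← integral_sub_right_eq_self (fun z : E3 => rexp (-(4 * b) * ‖z‖ ^ 2))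
    ((1 / 2 : ℝ) • (x + y)), ← integral_const_mul]
  congr 1
  ext z
  rw [← Real.exp_add, ← Real.exp_add]
  congr 1
  have h := parallelogram_law_with_norm ℝ (x - z) (y - z)
  have h1 : x - z + (y - z) = (-2 : ℝ) • (z - (1 / 2 : ℝ) • (x + y)) := by module
  have h2 : x - z - (y - z) = x - y := by abel
  rw [h1, h2, norm_smul] at h
  norm_num at h
  norm_num
  linear_combination b * h

lemma integral_gaussian_energy_nonneg {f : E3 → ℝ} (hf : Integrable f) {b : ℝ} (hb : 0 < b) :
    0 ≤ ∫ p : E3 × E3, f p.1 * f p.2 * rexp (-b * ‖p.1 - p.2‖ ^ 2) := by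
  have hc : 0 < ∫ z : E3, rexp (-(4 * b) * ‖z‖ ^ 2) := by
    rw [GaussianFourier.integral_rexp_neg_mul_sq_norm (by positivity)]
    positivity
  have hff : Integrable (fun p : E3 × E3 => f p.1 * f p.2) (volume.prod volume) := hf.mul_prod hf
  have hint : Integrable (fun p : E3 × E3 => f p.1 * f p.2 * rexp (-b * ‖p.1 - p.2‖ ^ 2))
      (volume.prod volume) := by
    refine hff.mul_bdd (c := 1) (by fun_prop) (ae_of_all _ fun p => ?_)
    rw [Real.norm_eq_abs, Real.abs_exp, Real.exp_le_one_iff]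
    have : 0 ≤ b * ‖p.1 - p.2‖ ^ 2 := by positivity
    linarith
  have hsw := integral_mul_integral_swap (μ := (volume : Measure E3).prod volume)
    (ν := (volume : Measure E3)) (F := fun p : E3 × E3 => f p.1 * f p.2)
    (G := fun p z => rexp (-(2 * b) * ‖p.1 - z‖ ^ 2) * rexp (-(2 * b) * ‖p.2 - z‖ ^ 2))
    hff.aestronglyMeasurable (by unfold Function.uncurry; fun_prop)
    (fun p z => by positivity)
    (ae_of_all _ fun p => by
      refine Integrable.of_integral_ne_zero ?_
      rw [integral_gaussian_mul_gaussian]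
      positivity)
    (by
      simp only [integral_gaussian_mul_gaussian, ← mul_assoc]
      exact hint.mul_const _)
  simp only [integral_gaussian_mul_gaussian, ← mul_assoc] at hsw
  rw [integral_mul_const] at hsw
  refine nonneg_of_mul_nonneg_left (b := ∫ z : E3, rexp (-(4 * b) * ‖z‖ ^ 2)) ?_ hc
  rw [Measure.volume_eq_prod, hsw]
  refine integral_nonneg fun z => ?_
  have : ∀ p : E3 × E3, f p.1 * f p.2 * rexp (-(2 * b) * ‖p.1 - z‖ ^ 2) *
      rexp (-(2 * b) * ‖p.2 - z‖ ^ 2) = (f p.1 * rexp (-(2 * b) * ‖p.1 - z‖ ^ 2)) *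
        (f p.2 * rexp (-(2 * b) * ‖p.2 - z‖ ^ 2)) := fun p => by ring
  simp only [this, Pi.zero_apply]
  rw [integral_prod_mul (fun x => f x * rexp (-(2 * b) * ‖x - z‖ ^ 2))
    (fun x => f x * rexp (-(2 * b) * ‖x - z‖ ^ 2))]
  exact mul_self_nonneg _

lemma coul_eq_integral_gaussian (x y : E3) :
    coul x y = ∫ s in Set.Ioi (0 : ℝ), 1 / (2 * π * √π) * rexp (-‖x - y‖ ^ 2 * s ^ 2) := by
  rw [integral_const_mul, integral_gaussian_Ioi, Real.sqrt_div Real.pi_pos.le,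
    Real.sqrt_sq (norm_nonneg _), coul]
  have := Real.sqrt_pos.2 Real.pi_pos
  field_simp
  norm_num

theorem coulEnergy_self_nonneg {f : E3 → ℝ} (hf : BddIntegrable f) : 0 ≤ coulEnergy f f := by
  have hint := integrable_prod_coul hf hf
  have hE : coulEnergy f f
      = ∫ p : E3 × E3, f p.1 * f p.2 * coul p.1 p.2 ∂(volume.prod volume) := by
    simp only [coulEnergy, coulPot, ← integral_const_mul]
    rw [← integral_prod _ hint]
    simp only [mul_assoc]
  have hdiag : ∀ᵐ p : E3 × E3 ∂(volume.prod volume), p.1 ≠ p.2 := by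
    have : (volume.prod volume) (Set.diagonal E3) = 0 := by
      rw [Measure.measure_prod_null measurableSet_diagonal]
      refine ae_of_all _ fun x => ?_
      have : Prod.mk x ⁻¹' Set.diagonal E3 = {x} := by
        ext y; simp [eq_comm]
      simp [this]
    exact compl_mem_ae_iff.2 this
  have hff : Integrable (fun p : E3 × E3 => f p.1 * f p.2) (volume.prod volume) :=
    hf.1.mul_prod hf.1
  rw [hE]
  simp only [coul_eq_integral_gaussian]
  rw [integral_mul_integral_swap hff.aestronglyMeasurable
    (by unfold Function.uncurry; fun_prop) (fun p s => by positivity)]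
  · refine setIntegral_nonneg measurableSet_Ioi fun s hs => ?_
    have h := integral_gaussian_energy_nonneg hf.1 (b := s ^ 2) (pow_pos hs 2)
    have h2 : ∀ p : E3 × E3, f p.1 * f p.2 * (1 / (2 * π * √π) *
        rexp (-‖p.1 - p.2‖ ^ 2 * s ^ 2)) =
        1 / (2 * π * √π) * (f p.1 * f p.2 * rexp (-s ^ 2 * ‖p.1 - p.2‖ ^ 2)) := by
      intro p
      rw [show -‖p.1 - p.2‖ ^ 2 * s ^ 2 = -s ^ 2 * ‖p.1 - p.2‖ ^ 2 by ring]
      ring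
    simp only [h2, integral_const_mul]
    exact mul_nonneg (by positivity) h
  · filter_upwards [hdiag] with p hp
    have : 0 < ‖p.1 - p.2‖ := norm_sub_pos_iff.2 hp
    refine Integrable.const_mul ?_ _
    exact (integrable_exp_neg_mul_sq (b := ‖p.1 - p.2‖ ^ 2) (by positivity)).integrableOn
  · simpa only [coul_eq_integral_gaussian, mul_assoc] using hint

lemma coulPot_indicator_ball (c y : E3) (r : ℝ) :
    coulPot ((Metric.ball c r).indicator fun _ => (1 : ℝ)) y = ∫ x in Metric.ball c r, coul x y := by
  rw [coulPot, ← integral_indicator measurableSet_ball]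
  congr 1
  ext x
  by_cases h : x ∈ Metric.ball c r <;> simp [h, coul_comm y x]

lemma bddIntegrable_ball (c : E3) (r : ℝ) :
    BddIntegrable ((Metric.ball c r).indicator fun _ => (1 : ℝ)) :=
  bddIntegrable_indicator_one measurableSet_ball measure_ball_lt_top.ne

lemma coulEnergy_indicator_ball (f : E3 → ℝ) (c : E3) (r : ℝ) :
    coulEnergy ((Metric.ball c r).indicator fun _ => (1 : ℝ)) f
      = ∫ x in Metric.ball c r, coulPot f x := by
  rw [coulEnergy, ← integral_indicator measurableSet_ball]
  congr 1
  ext x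
  by_cases h : x ∈ Metric.ball c r <;> simp [h]

lemma setIntegral_ball_coulPot {f : E3 → ℝ} (hf : BddIntegrable f) (c : E3) (r : ℝ) :
    ∫ x in Metric.ball c r, coulPot f x = ∫ y, f y * ∫ x in Metric.ball c r, coul x y := by
  rw [← coulEnergy_indicator_ball, coulEnergy_comm (bddIntegrable_ball c r) hf]
  simp only [coulEnergy, coulPot_indicator_ball]

lemma integrable_mul_setIntegral_ball_coul {f : E3 → ℝ} (hf : BddIntegrable f) (c : E3) (r : ℝ) :
    Integrable fun y => f y * ∫ x in Metric.ball c r, coul x y := by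
  simpa only [coulPot_indicator_ball] using integrable_mul_coulPot hf (bddIntegrable_ball c r)

/-- Superharmonicity of the potential on balls carrying nonnegative charge. -/
lemma setIntegral_ball_coulPot_le {f : E3 → ℝ} (hf : BddIntegrable f) {c : E3} {r : ℝ}
    (hr : 0 < r) (hpos : ∀ᵐ y, y ∈ Metric.ball c r → 0 ≤ f y) :
    ∫ x in Metric.ball c r, coulPot f x ≤ volume.real (Metric.ball c r) * coulPot f c := by
  rw [setIntegral_ball_coulPot hf, coulPot, ← integral_const_mul]
  refine integral_mono_ae (integrable_mul_setIntegral_ball_coul hf c r)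
    ((integrable_mul_coul hf c).const_mul _) ?_
  filter_upwards [hpos, compl_mem_ae_iff.2 (measure_singleton c)] with y hy hne
  change f y * _ ≤ _ * (f y * coul c y)
  rw [mul_left_comm]
  by_cases h : y ∈ Metric.ball c r
  · exact mul_le_mul_of_nonneg_left (integral_ball_coul_le_mul hr hne) (hy h)
  · rw [Metric.mem_ball, dist_eq_norm, not_lt] at h
    rw [integral_ball_coul_eq_mul hr h]

/-- The minimum principle: a potential is nonnegative if the charge is nonnegative wherever the
potential is negative. -/
theorem coulPot_nonneg {f : E3 → ℝ} (hf : BddIntegrable f)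
    (hpos : ∀ᵐ y, coulPot f y < 0 → 0 ≤ f y) (x : E3) : 0 ≤ coulPot f x := by
  by_contra! hx
  have hcont := continuous_coulPot hf
  have hlim := tendsto_coulPot hf
  obtain ⟨x₀, hx₀⟩ : ∃ x₀, ∀ y, coulPot f x₀ ≤ coulPot f y :=
    hcont.exists_forall_le' x ((hlim.eventually_const_lt hx).mono fun _ => le_of_lt)
  have hneg : coulPot f x₀ < 0 := (hx₀ x).trans_lt hx
  have hopen : IsOpen {y | coulPot f y = coulPot f x₀} := by
    refine Metric.isOpen_iff.2 fun c (hc : _ = _) => ?_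
    obtain ⟨r, hr, hball⟩ := Metric.isOpen_iff.1 (isOpen_lt hcont continuous_const) c
      (hc.trans_lt hneg : coulPot f c < 0)
    refine ⟨r, hr, ?_⟩
    have hle := setIntegral_ball_coulPot_le hf hr (hpos.mono fun y hy h => hy (hball h))
    have hi : IntegrableOn (fun y => coulPot f y - coulPot f x₀) (Metric.ball c r) :=
      ((hcont.sub continuous_const).continuousOn.integrableOn_compact
        (isCompact_closedBall c r)).mono_set Metric.ball_subset_closedBall
    have hz : ∫ y in Metric.ball c r, (coulPot f y - coulPot f x₀) = 0 := by
      refine le_antisymm ?_ (integral_nonneg fun y => sub_nonneg.2 (hx₀ y))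
      have hi₂ : IntegrableOn (coulPot f) (Metric.ball c r) :=
        (hcont.continuousOn.integrableOn_compact (isCompact_closedBall c r)).mono_set
          Metric.ball_subset_closedBall
      rw [integral_sub hi₂ (integrableOn_const measure_ball_lt_top.ne), setIntegral_const,
        smul_eq_mul, ← hc]
      linarith
    rw [integral_eq_zero_iff_of_nonneg (fun y => sub_nonneg.2 (hx₀ y)) hi] at hz
    have heq := Measure.eqOn_open_of_ae_eq hz Metric.isOpen_ball
      (hcont.sub continuous_const).continuousOn continuousOn_const
    exact fun y hy => sub_eq_zero.1 (heq hy)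
  have hclopen : IsClopen {y | coulPot f y = coulPot f x₀} :=
    ⟨isClosed_eq hcont continuous_const, hopen⟩
  have huniv := hclopen.eq_univ ⟨x₀, rfl⟩
  have hconst : coulPot f = fun _ => coulPot f x₀ := funext fun y => Set.eq_univ_iff_forall.1 huniv y
  rw [hconst] at hlim
  exact hneg.ne (tendsto_nhds_unique tendsto_const_nhds hlim)

/-- The total charge is read off from the far field. -/
lemma tendsto_setIntegral_ball_coulPot {f : E3 → ℝ} (hf : BddIntegrable f) :
    Tendsto (fun R : ℝ => (∫ x in Metric.ball 0 R, coulPot f x) / R ^ 2) atTop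
      (nhds ((∫ x, f x) / 2)) := by
  simp only [setIntegral_ball_coulPot hf, ← integral_div]
  refine tendsto_integral_filter_of_dominated_convergence (fun y => |f y|) ?_ ?_ hf.1.abs ?_
  · exact Eventually.of_forall fun R =>
      ((integrable_mul_setIntegral_ball_coul hf 0 R).div_const _).aestronglyMeasurable
  · filter_upwards [eventually_gt_atTop 0] with R hR
    filter_upwards [compl_mem_ae_iff.2 (measure_singleton (0 : E3))] with y hy
    rw [mul_div_assoc, norm_mul, Real.norm_eq_abs]
    refine mul_le_of_le_one_right (abs_nonneg _) ?_
    have h0 : 0 ≤ ∫ x in Metric.ball 0 R, coul x y := integral_nonneg fun x => coul_nonneg x y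
    rw [Real.norm_of_nonneg (by positivity), div_le_one (by positivity)]
    have := integral_ball_zero_coul_le hR hy
    nlinarith [pow_pos hR 2]
  · filter_upwards [compl_mem_ae_iff.2 (measure_singleton (0 : E3))] with y hy
    have h1 : Tendsto (fun R : ℝ => f y * ((1 - ‖y‖ ^ 2 / 3 * (R ^ 2)⁻¹) / 2)) atTop
        (nhds (f y * ((1 - ‖y‖ ^ 2 / 3 * 0) / 2))) := by
      have h0 : Tendsto (fun R : ℝ => (R ^ 2)⁻¹) atTop (nhds 0) :=
        (tendsto_pow_atTop two_ne_zero).inv_tendsto_atTop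
      exact ((((h0.const_mul _).const_sub _).div_const _).const_mul _)
    rw [mul_zero, sub_zero, mul_one_div] at h1
    refine h1.congr' ?_
    filter_upwards [eventually_gt_atTop 0, eventually_ge_atTop ‖y‖] with R hR hyR
    rw [integral_ball_zero_coul hR hy, if_pos hyR]
    field_simp

lemma relEnergy_eq_coulEnergy (Ωp : Set E3) (u : E3 → ℝ) :
    relEnergy Ωp u = coulEnergy (fun x => Ωp.indicator (fun _ => (1 : ℝ)) x - u x)
      (fun x => Ωp.indicator (fun _ => (1 : ℝ)) x - u x) := by
  simp only [relEnergy, coulEnergy, coulPot, integral_const_mul]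

lemma RelAdm.bddIntegrable {Ωp : Set E3} {lam : ℝ} {u : E3 → ℝ} (hu : RelAdm Ωp lam u) :
    BddIntegrable u := by
  refine ⟨hu.1, 1, zero_le_one, ?_⟩
  filter_upwards [hu.2.1] with x hx
  rw [abs_of_nonneg hx.1]
  exact hx.2

lemma RelAdm.bddIntegrable_charge {Ωp : Set E3} (ho : MeasurableSet Ωp) (hfin : volume Ωp ≠ ⊤)
    {lam : ℝ} {u : E3 → ℝ} (hu : RelAdm Ωp lam u) :
    BddIntegrable fun x => Ωp.indicator (fun _ => (1 : ℝ)) x - u x := by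
  have := (bddIntegrable_indicator_one ho hfin).add_const_mul hu.bddIntegrable (-1)
  convert this using 2
  ring

lemma integral_charge {Ωp : Set E3} (ho : MeasurableSet Ωp) (hfin : volume Ωp ≠ ⊤) {u : E3 → ℝ}
    (hu : Integrable u) :
    ∫ x, (Ωp.indicator (fun _ => (1 : ℝ)) x - u x) = volume.real Ωp - ∫ x, u x := by
  rw [integral_sub (bddIntegrable_indicator_one ho hfin).1 hu, integral_indicator ho]
  simp

lemma exists_relEnergy_lt {Ωp : Set E3} (ho : MeasurableSet Ωp) (hfin : volume Ωp ≠ ⊤)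
    {lam μ : ℝ} {u : E3 → ℝ} (hu : RelAdm Ωp lam u) (hlt : ∫ x, u x < volume.real Ωp)
    (hμ : ∫ x, u x < μ) : ∃ u', RelAdm Ωp μ u' ∧ relEnergy Ωp u' < relEnergy Ωp u := by
  set f : E3 → ℝ := fun x => Ωp.indicator (fun _ => (1 : ℝ)) x - u x with hf_def
  have hf : BddIntegrable f := hu.bddIntegrable_charge ho hfin
  let w : E3 → ℝ := fun x => Ωp.indicator (fun _ => (1 : ℝ)) x + 1 * u x
  have hw : BddIntegrable w := (bddIntegrable_indicator_one ho hfin).add_const_mul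
    hu.bddIntegrable 1
  obtain ⟨K, hK⟩ := exists_abs_coulPot_le hf
  let v : ℝ → E3 → ℝ := fun R x => (Metric.ball (0 : E3) R).indicator (fun _ => (1 : ℝ)) x +
    (-1) * (Metric.ball (0 : E3) R).indicator w x
  have hv : ∀ R, BddIntegrable (v R) := fun R =>
    (bddIntegrable_ball 0 R).add_const_mul (hw.indicator measurableSet_ball) (-1)
  have hvE : ∀ R, (∫ x in Metric.ball 0 R, coulPot f x) - (∫ x, |w x|) * K
      ≤ coulEnergy (v R) f := by
    intro R
    have hwR := hw.indicator (measurableSet_ball (x := (0 : E3)) (ε := R))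
    have h1 : coulEnergy (v R) f = (∫ x in Metric.ball 0 R, coulPot f x)
        - ∫ x, (Metric.ball (0 : E3) R).indicator w x * coulPot f x := by
      rw [← coulEnergy_indicator_ball, coulEnergy, coulEnergy,
        ← integral_sub (integrable_mul_coulPot (bddIntegrable_ball 0 R) hf)
          (integrable_mul_coulPot hwR hf)]
      congr 1
      ext x
      simp only [v]
      ring
    have h2 : ∫ x, (Metric.ball (0 : E3) R).indicator w x * coulPot f x ≤ (∫ x, |w x|) * K := by
      rw [← integral_mul_const]
      refine integral_mono (integrable_mul_coulPot hwR hf) (hw.1.abs.mul_const K) fun x => ?_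
      refine (le_abs_self _).trans ?_
      rw [abs_mul]
      refine mul_le_mul ?_ (hK x) (abs_nonneg _) (abs_nonneg _)
      by_cases h : x ∈ Metric.ball (0 : E3) R <;> simp [h]
    linarith
  obtain ⟨R, hR⟩ : ∃ R, 0 < coulEnergy (v R) f := by
    have hlim := tendsto_setIntegral_ball_coulPot hf
    rw [integral_charge ho hfin hu.1] at hlim
    set δ := (volume.real Ωp - ∫ x, u x) / 2 with hδ_def
    have hδ : 0 < δ := by rw [hδ_def]; linarith
    have hbig : Tendsto (fun R : ℝ => δ / 2 * R ^ 2) atTop atTop :=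
      (tendsto_pow_atTop two_ne_zero).const_mul_atTop (by positivity)
    obtain ⟨R, h1, h2, h3⟩ := ((hlim.eventually_const_lt (half_lt_self hδ)).and
      ((hbig.eventually_gt_atTop ((∫ x, |w x|) * K)).and (eventually_gt_atTop 0))).exists
    refine ⟨R, ?_⟩
    rw [lt_div_iff₀ (by positivity)] at h1
    linarith [hvE R]
  have hcont : Tendsto (fun ε : ℝ => -2 * coulEnergy (v R) f + ε * coulEnergy (v R) (v R))
      (nhdsWithin 0 (Set.Ioi 0)) (nhds (-2 * coulEnergy (v R) f)) := by
    have : Continuous fun ε : ℝ => -2 * coulEnergy (v R) f + ε * coulEnergy (v R) (v R) := by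
      fun_prop
    simpa using (this.tendsto 0).mono_left nhdsWithin_le_nhds
  have hmass : Tendsto (fun ε : ℝ => (∫ x, u x) + ε * ∫ x, v R x)
      (nhdsWithin 0 (Set.Ioi 0)) (nhds (∫ x, u x)) := by
    have : Continuous fun ε : ℝ => (∫ x, u x) + ε * ∫ x, v R x := by fun_prop
    simpa using (this.tendsto 0).mono_left nhdsWithin_le_nhds
  have hneg : -2 * coulEnergy (v R) f < 0 := by linarith
  obtain ⟨ε, ⟨h1, h2⟩, h3, h4⟩ := (((hcont.eventually_lt_const hneg).and
    (hmass.eventually_lt_const hμ)).and (Ioo_mem_nhdsGT one_pos)).exists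
  refine ⟨fun x => u x + ε * v R x, ⟨hu.1.add ((hv R).1.const_mul ε), ?_, ?_, ?_⟩, ?_⟩
  · filter_upwards [hu.2.1, hu.2.2.1] with x hx hx'
    by_cases hB : x ∈ Metric.ball (0 : E3) R
    · by_cases hΩ : x ∈ Ωp
      · simp only [v, w, Set.indicator_of_mem hB, Set.indicator_of_mem hΩ, hx' hΩ]
        norm_num
      · simp only [v, w, Set.indicator_of_mem hB, Set.indicator_of_notMem hΩ]
        constructor <;> nlinarith [hx.1, hx.2]
    · simpa [v, Set.indicator_of_notMem hB] using hx
  · filter_upwards [hu.2.2.1] with x hx hΩ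
    by_cases hB : x ∈ Metric.ball (0 : E3) R
    · simp only [v, w, Set.indicator_of_mem hB, Set.indicator_of_mem hΩ, hx hΩ]
      norm_num
    · simp [v, Set.indicator_of_notMem hB, hx hΩ]
  · rw [integral_add hu.1 ((hv R).1.const_mul ε), integral_const_mul]
    exact h2.le
  · rw [relEnergy_eq_coulEnergy, relEnergy_eq_coulEnergy, ← hf_def]
    have : (fun x => Ωp.indicator (fun _ => (1 : ℝ)) x - (u x + ε * v R x))
        = fun x => f x + (-ε) * v R x := by
      ext x; simp only [hf_def]; ring
    rw [this, coulEnergy_add_const_mul hf (hv R), coulEnergy_comm hf (hv R)]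
    nlinarith [mul_neg_of_pos_of_neg h3 h1]

lemma integral_le_of_forall_relEnergy_le {Ωp : Set E3} (ho : MeasurableSet Ωp)
    (hfin : volume Ωp ≠ ⊤) {lam : ℝ} {u : E3 → ℝ} (hu : RelAdm Ωp lam u)
    (hmin : ∀ u', RelAdm Ωp lam u' → relEnergy Ωp u ≤ relEnergy Ωp u') :
    ∫ x, u x ≤ volume.real Ωp := by
  set f : E3 → ℝ := fun x => Ωp.indicator (fun _ => (1 : ℝ)) x - u x with hf_def
  have hf : BddIntegrable f := hu.bddIntegrable_charge ho hfin
  have hS : MeasurableSet {x | coulPot f x < 0} :=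
    (isOpen_lt (continuous_coulPot hf) continuous_const).measurableSet
  let v : E3 → ℝ := {x | coulPot f x < 0}.indicator u
  have hv : BddIntegrable v := hu.bddIntegrable.indicator hS
  have hv0 : ∀ᵐ x, 0 ≤ v x ∧ v x ≤ u x := by
    filter_upwards [hu.2.1] with x hx
    by_cases h : x ∈ {x | coulPot f x < 0}
    · simp [v, Set.indicator_of_mem h, hx.1]
    · simp [v, Set.indicator_of_notMem h, hx.1]
  have hvar : 0 ≤ coulEnergy f v := by
    have hε : ∀ ε ∈ Set.Ioo (0 : ℝ) 1, 0 ≤ 2 * coulEnergy f v + ε * coulEnergy v v := by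
      rintro ε ⟨h0, h1⟩
      have hadm : RelAdm Ωp lam fun x => u x + (-ε) * v x := by
        refine ⟨hu.1.add (hv.1.const_mul (-ε)), ?_, ?_, ?_⟩
        · filter_upwards [hu.2.1, hv0] with x hx hvx
          constructor <;> nlinarith [hx.1, hx.2, hvx.1, hvx.2]
        · filter_upwards [hu.2.2.1, hv0] with x hx hvx hΩ
          have hux := hx hΩ
          rw [hux] at hvx ⊢
          rw [le_antisymm hvx.2 hvx.1]
          simp
        · rw [integral_add hu.1 (hv.1.const_mul (-ε)), integral_const_mul]
          have : 0 ≤ ∫ x, v x := integral_nonneg_of_ae (hv0.mono fun x hx => hx.1)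
          nlinarith [hu.2.2.2]
      have h := hmin _ hadm
      rw [relEnergy_eq_coulEnergy, relEnergy_eq_coulEnergy, ← hf_def] at h
      have he : (fun x => Ωp.indicator (fun _ => (1 : ℝ)) x - (u x + (-ε) * v x))
          = fun x => f x + ε * v x := by
        ext x; simp only [hf_def]; ring
      rw [he, coulEnergy_add_const_mul hf hv] at h
      refine nonneg_of_mul_nonneg_right (a := ε) ?_ h0
      linarith
    have hcont : Continuous fun ε : ℝ => 2 * coulEnergy f v + ε * coulEnergy v v := by fun_prop
    have hlim : Tendsto (fun ε : ℝ => 2 * coulEnergy f v + ε * coulEnergy v v)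
        (nhdsWithin 0 (Set.Ioi 0)) (nhds (2 * coulEnergy f v)) := by
      simpa using (hcont.tendsto 0).mono_left nhdsWithin_le_nhds
    have := ge_of_tendsto hlim (mem_of_superset (Ioo_mem_nhdsGT one_pos) hε)
    linarith
  have hzero : ∀ᵐ x, v x * coulPot f x = 0 := by
    rw [coulEnergy_comm hf hv, coulEnergy] at hvar
    have hle : ∀ᵐ x, 0 ≤ -(v x * coulPot f x) := by
      filter_upwards [hv0] with x hx
      by_cases h : x ∈ {x | coulPot f x < 0}
      · have : coulPot f x < 0 := h
        nlinarith [hx.1]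
      · simp [v, Set.indicator_of_notMem h]
    have hint : ∫ x, -(v x * coulPot f x) = 0 := by
      refine le_antisymm ?_ (integral_nonneg_of_ae hle)
      rw [integral_neg]
      linarith
    rw [integral_eq_zero_iff_of_nonneg_ae hle (integrable_mul_coulPot hv hf).neg] at hint
    filter_upwards [hint] with x hx using neg_eq_zero.1 hx
  have hpot : ∀ x, 0 ≤ coulPot f x := by
    refine coulPot_nonneg hf ?_
    filter_upwards [hzero] with x hx hneg
    have hvu : v x = u x := Set.indicator_of_mem (s := {x | coulPot f x < 0}) hneg u
    rw [hvu] at hx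
    have hu0 : u x = 0 := (mul_eq_zero.1 hx).resolve_right hneg.ne
    simp only [hf_def, hu0, sub_zero]
    exact Set.indicator_nonneg (fun _ _ => zero_le_one) x
  have hlim := tendsto_setIntegral_ball_coulPot hf
  rw [integral_charge ho hfin hu.1] at hlim
  have := ge_of_tendsto' hlim fun R =>
    div_nonneg (integral_nonneg fun x => hpot x) (sq_nonneg R)
  linarith

lemma RelAdm.mono {Ωp : Set E3} {lam μ : ℝ} {u : E3 → ℝ} (hu : RelAdm Ωp lam u) (h : lam ≤ μ) :
    RelAdm Ωp μ u :=
  ⟨hu.1, hu.2.1, hu.2.2.1, hu.2.2.2.trans h⟩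

lemma RelAdm.convex_comb {Ωp : Set E3} {lam μ : ℝ} {u₁ u₂ : E3 → ℝ} (h₁ : RelAdm Ωp lam u₁)
    (h₂ : RelAdm Ωp μ u₂) {a b : ℝ} (ha : 0 ≤ a) (hb : 0 ≤ b) (hab : a + b = 1) :
    RelAdm Ωp (a * lam + b * μ) fun x => a * u₁ x + b * u₂ x := by
  refine ⟨(h₁.1.const_mul a).add (h₂.1.const_mul b), ?_, ?_, ?_⟩
  · filter_upwards [h₁.2.1, h₂.2.1] with x hx hy
    constructor <;> nlinarith [hx.1, hx.2, hy.1, hy.2]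
  · filter_upwards [h₁.2.2.1, h₂.2.2.1] with x hx hy hΩ
    simp [hx hΩ, hy hΩ]
  · rw [integral_add (h₁.1.const_mul a) (h₂.1.const_mul b), integral_const_mul,
      integral_const_mul]
    have := mul_le_mul_of_nonneg_left h₁.2.2.2 ha
    have := mul_le_mul_of_nonneg_left h₂.2.2.2 hb
    linarith

lemma relEnergy_convex_comb_le {Ωp : Set E3} (ho : MeasurableSet Ωp) (hfin : volume Ωp ≠ ⊤)
    {lam μ : ℝ} {u₁ u₂ : E3 → ℝ} (h₁ : RelAdm Ωp lam u₁) (h₂ : RelAdm Ωp μ u₂) {a b : ℝ}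
    (ha : 0 ≤ a) (hb : 0 ≤ b) (hab : a + b = 1) :
    relEnergy Ωp (fun x => a * u₁ x + b * u₂ x) ≤ a * relEnergy Ωp u₁ + b * relEnergy Ωp u₂ := by
  have hf := h₁.bddIntegrable_charge ho hfin
  have hg : BddIntegrable fun x => u₁ x + (-1) * u₂ x :=
    h₁.bddIntegrable.add_const_mul h₂.bddIntegrable (-1)
  have e₁ := coulEnergy_add_const_mul hf hg b
  have e₂ := coulEnergy_add_const_mul hf hg 1
  simp only [relEnergy_eq_coulEnergy]
  have c₁ : (fun x => Ωp.indicator (fun _ => (1 : ℝ)) x - (a * u₁ x + b * u₂ x))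
      = fun x => Ωp.indicator (fun _ => (1 : ℝ)) x - u₁ x + b * (u₁ x + (-1) * u₂ x) := by
    ext x
    rw [eq_sub_of_add_eq hab]
    ring
  have c₂ : (fun x => Ωp.indicator (fun _ => (1 : ℝ)) x - u₂ x)
      = fun x => Ωp.indicator (fun _ => (1 : ℝ)) x - u₁ x + 1 * (u₁ x + (-1) * u₂ x) := by
    ext x
    ring
  rw [c₁, c₂, e₁, e₂, eq_sub_of_add_eq hab]
  have hb1 : b ≤ 1 := by linarith
  nlinarith [mul_nonneg (mul_nonneg hb (sub_nonneg.2 hb1)) (coulEnergy_self_nonneg hg)]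

/-- **Corollary 3.7** (Minimal energy as a function of `λ`): the minimal
relaxed energy `e(λ)` is continuous on `(0,∞)`, strictly decreasing on
`(0, m]`, and constant on `[m, ∞)`. -/
theorem minimal_energy_monotonicity
    (Ωp : Set E3) (ho : IsOpen Ωp) (hb : Bornology.IsBounded Ωp)
    (m : ℝ) (hm : 0 < m) (hvol : volume Ωp = ENNReal.ofReal m)
    (e : ℝ → ℝ)
    (he : ∀ lam : ℝ, 0 < lam →
      IsLeast {E : ℝ | ∃ u : E3 → ℝ, RelAdm Ωp lam u ∧ relEnergy Ωp u = E} (e lam)) :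
    ContinuousOn e (Set.Ioi (0:ℝ)) ∧
    StrictAntiOn e (Set.Ioc (0:ℝ) m) ∧
    (∀ lam : ℝ, m ≤ lam → e lam = e m) := by
  have hΩ := ho.measurableSet
  have hfin : volume Ωp ≠ ⊤ := by rw [hvol]; exact ENNReal.ofReal_ne_top
  have hvol' : volume.real Ωp = m := by rw [Measure.real, hvol, ENNReal.toReal_ofReal hm.le]
  have hle : ∀ {lam : ℝ}, 0 < lam → ∀ {u}, RelAdm Ωp lam u → e lam ≤ relEnergy Ωp u :=
    fun hlam u hu => (he _ hlam).2 ⟨u, hu, rfl⟩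
  have hanti : ∀ {lam μ : ℝ}, 0 < lam → lam ≤ μ → e μ ≤ e lam := by
    intro lam μ hlam hμ
    obtain ⟨u, hu, hE⟩ := (he lam hlam).1
    exact hE ▸ hle (hlam.trans_le hμ) (hu.mono hμ)
  have hconv : ConvexOn ℝ (Set.Ioi 0) e := by
    refine ⟨convex_Ioi 0, fun lam hlam μ hμ a b ha hb hab => ?_⟩
    obtain ⟨u₁, h₁, hE₁⟩ := (he lam hlam).1
    obtain ⟨u₂, h₂, hE₂⟩ := (he μ hμ).1
    have hpos : 0 < a * lam + b * μ := convex_Ioi (0 : ℝ) hlam hμ ha hb hab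
    have := (hle hpos (h₁.convex_comb h₂ ha hb hab)).trans
      (relEnergy_convex_comb_le hΩ hfin h₁ h₂ ha hb hab)
    rwa [hE₁, hE₂] at this
  have hstrict : ∀ {lam : ℝ}, 0 < lam → lam < m → e m < e lam := by
    intro lam hlam hlm
    obtain ⟨u, hu, hE⟩ := (he lam hlam).1
    have hum := hu.2.2.2.trans_lt hlm
    obtain ⟨u', hu', hlt⟩ := exists_relEnergy_lt hΩ hfin hu (hvol' ▸ hum) hum
    exact hE ▸ (hle hm hu').trans_lt hlt
  refine ⟨hconv.continuousOn isOpen_Ioi, ?_, ?_⟩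
  · rintro x ⟨hx, hxm⟩ y ⟨hy, hym⟩ hxy
    rcases hym.eq_or_lt with rfl | hym
    · exact hstrict hx hxy
    have hx' : x < m := hxy.trans hym
    have hd : 0 < m - x := sub_pos.2 hx'
    have ha0 : 0 ≤ (m - y) / (m - x) := div_nonneg (by linarith) hd.le
    have hb0 : 0 ≤ (y - x) / (m - x) := div_nonneg (by linarith) hd.le
    have hab : (m - y) / (m - x) + (y - x) / (m - x) = 1 := by
      rw [← add_div]
      exact (div_eq_one_iff_eq hd.ne').2 (by ring)
    have h := hconv.2 (Set.mem_Ioi.2 hx) (Set.mem_Ioi.2 hm) ha0 hb0 hab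
    have hcomb : ((m - y) / (m - x)) • x + ((y - x) / (m - x)) • m = y := by
      simp only [smul_eq_mul]
      field_simp
      ring
    rw [hcomb, smul_eq_mul, smul_eq_mul] at h
    refine h.trans_lt ?_
    have hb : 0 < (y - x) / (m - x) := div_pos (by linarith) hd
    have ha : (m - y) / (m - x) = 1 - (y - x) / (m - x) := by
      field_simp
      ring
    rw [ha]
    nlinarith [mul_lt_mul_of_pos_left (hstrict hx hx') hb]
  · intro lam hlam
    have hpos := hm.trans_le hlam
    refine le_antisymm (hanti hm hlam) ?_
    obtain ⟨u, hu, hE⟩ := (he lam hpos).1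
    have hmass := integral_le_of_forall_relEnergy_le hΩ hfin hu fun u' hu' => hE ▸ hle hpos hu'
    rw [hvol'] at hmass
    exact hE ▸ hle hm ⟨hu.1, hu.2.1, hu.2.2.1, hmass⟩
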